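/- Let s : ℝ² → ℝ be skew-symmetric (s(x,y) = -s(y,x)) and integrable on Q_τ = (-∞,τ)×(τ,∞) for each τ ∈ ℝ as well as on (a,b)×ℝ. Then for a < b, ∬_{(a,b)×ℝ} s(x,y) dy dx = ∬_{Q_b} s dx dy - ∬_{Q_a} s dx dy. -/

import Mathlib

open MeasureTheory Set

theorem nibp_swap (s : ℝ × ℝ → ℝ) (hskew : ∀ x y : ℝ, s (x, y) = - s (y, x)) (A B : Set ℝ) :
    ∫ p in A ×ˢ B, s p = - ∫ p in B ×ˢ A, s p := by
  have h := setIntegral_prod_swap (μ := (volume : Measure ℝ)) (ν := (volume : Measure ℝ)) A B s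
  rw [← Measure.volume_eq_prod] at h
  rw [← h, ← integral_neg]
  congr 1
  ext p
  rw [← hskew]
  rfl

theorem nibp_ae {A B : Set ℝ} (a b : ℝ) (h : ∀ x, x ≠ a → x ≠ b → (x ∈ A ↔ x ∈ B)) :
    A =ᵐ[volume] B := by
  have ha : ∀ᵐ x : ℝ, x ≠ a := by simp [ae_iff]
  have hb : ∀ᵐ x : ℝ, x ≠ b := by simp [ae_iff]
  filter_upwards [ha, hb] with x h1 h2
  exact propext (h x h1 h2)

theorem nonlocal_integration_by_parts (s : ℝ × ℝ → ℝ) (hmeas : Measurable s)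
    (hskew : ∀ x y : ℝ, s (x, y) = - s (y, x))
    (hQ : ∀ τ : ℝ, IntegrableOn s (Iio τ ×ˢ Ioi τ))
    (a b : ℝ) (hab : a < b)
    (hstrip : IntegrableOn s (Ioo a b ×ˢ (univ : Set ℝ))) :
    (∫ p in (Ioo a b ×ˢ (univ : Set ℝ)), s p) =
      (∫ p in (Iio b ×ˢ Ioi b), s p) - ∫ p in (Iio a ×ˢ Ioi a), s p := by
  have e1 : (Ioo a b ×ˢ (univ : Set ℝ) : Set (ℝ × ℝ)) =ᵐ[volume]
      (Ioo a b ×ˢ (Iio a) ∪ (Ioo a b ×ˢ Ioo a b ∪ Ioo a b ×ˢ Ioi b) : Set (ℝ × ℝ)) := by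
    rw [← prod_union, ← prod_union]
    refine Measure.set_prod_ae_eq (ae_eq_refl _) (nibp_ae a b fun x h1 h2 => ?_)
    simp only [mem_univ, mem_union, mem_Iio, mem_Ioo, mem_Ioi]
    grind
  have e2 : (Iio b ×ˢ Ioi b : Set (ℝ × ℝ)) =ᵐ[volume] (Iio a ×ˢ Ioi b ∪ Ioo a b ×ˢ Ioi b : Set (ℝ × ℝ)) := by
    rw [← union_prod]
    refine Measure.set_prod_ae_eq (nibp_ae a b fun x h1 h2 => ?_) (ae_eq_refl _)
    simp only [mem_union, mem_Iio, mem_Ioo]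
    grind
  have e3 : (Iio a ×ˢ Ioi a : Set (ℝ × ℝ)) =ᵐ[volume] (Iio a ×ˢ Ioo a b ∪ Iio a ×ˢ Ioi b : Set (ℝ × ℝ)) := by
    rw [← prod_union]
    refine Measure.set_prod_ae_eq (ae_eq_refl _) (nibp_ae a b fun x h1 h2 => ?_)
    simp only [mem_union, mem_Ioi, mem_Ioo]
    grind
  have i1 : ∀ B, IntegrableOn s (Ioo a b ×ˢ B) := fun B =>
    hstrip.mono_set (prod_mono_right (subset_univ _))
  have i2 : IntegrableOn s (Iio a ×ˢ Ioi b) :=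
    (hQ a).mono_set (prod_mono_right (Ioi_subset_Ioi hab.le))
  have i3 : IntegrableOn s (Iio a ×ˢ Ioo a b) :=
    (hQ a).mono_set (prod_mono_right Ioo_subset_Ioi_self)
  have m1 : MeasurableSet (Ioo a b ×ˢ Ioo a b) := measurableSet_Ioo.prod measurableSet_Ioo
  have m2 : MeasurableSet (Ioo a b ×ˢ Ioi b) := measurableSet_Ioo.prod measurableSet_Ioi
  have m3 : MeasurableSet (Iio a ×ˢ Ioi b) := measurableSet_Iio.prod measurableSet_Ioi
  rw [setIntegral_congr_set e1, setIntegral_congr_set e2, setIntegral_congr_set e3,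
    setIntegral_union ?_ (m1.union m2) (i1 _) ((i1 _).union (i1 _)),
    setIntegral_union ?_ m2 (i1 _) (i1 _), setIntegral_union ?_ m2 i2 (i1 _),
    setIntegral_union ?_ m3 i3 i2]
  · have h1 := nibp_swap s hskew (Ioo a b) (Ioo a b)
    have h2 := nibp_swap s hskew (Ioo a b) (Iio a)
    linarith
  all_goals
    rw [Set.disjoint_left]
    rintro ⟨x, y⟩
    simp only [mem_union, mem_prod, mem_Ioi, mem_Ioo, mem_Iio]
    grind
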